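/- Let n≥1 and k≥1 be integers. The map sending a tuple ((e_{ij})_{1≤i<j≤n},(x_i)_{1≤i≤n}) of complex numbers satisfying e_{ij}(e_{ij}−1)=0 for all 1≤i<j≤n, x_i^k−1=0 for all 1≤i≤n, and e_{ij}(x_i^{k−1}+x_i^{k−2}x_j+⋯+x_j^{k−1})=0 for all 1≤i<j≤n, to the pair (G,c) where G is the simple graph on vertex set {1,…,n} with i and j adjacent if and only if e_{ij}=1, and c(i)=x_i, is a bijection onto the set of pairs (G,c) consisting of a simple graph G on vertex set {1,…,n} together with a map c from {1,…,n} to the set of k-th roots of unity such that c(i)≠c(j) whenever i and j are adjacent in G (i.e., a proper k-coloring of G by k-th roots of unity). -/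

import Mathlib

open SimpleGraph

/-- The index set for the edge variables `e_{ij}` with `1 ≤ i < j ≤ n`. -/
abbrev EIdx (n : ℕ) := {p : Fin n × Fin n // p.1 < p.2}

/-- The solution set of the system of equations
`e_{ij}(e_{ij} - 1) = 0`, `x_i^k - 1 = 0`,
`e_{ij}(x_i^{k-1} + x_i^{k-2} x_j + ⋯ + x_j^{k-1}) = 0`. -/
def SolSet (n k : ℕ) : Set ((EIdx n → ℂ) × (Fin n → ℂ)) :=
  {p | (∀ q : EIdx n, p.1 q * (p.1 q - 1) = 0) ∧
       (∀ i : Fin n, p.2 i ^ k - 1 = 0) ∧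
       (∀ q : EIdx n,
         p.1 q * ∑ t ∈ Finset.range k, p.2 q.1.1 ^ (k - 1 - t) * p.2 q.1.2 ^ t = 0)}

/-- The set of pairs `(G, c)` of a labeled simple graph on `{1,…,n}` together with a
proper `k`-coloring of `G` by `k`-th roots of unity. -/
def ColoredGraphSet (n k : ℕ) : Set (SimpleGraph (Fin n) × (Fin n → ℂ)) :=
  {q | (∀ i : Fin n, q.2 i ^ k = 1) ∧ ∀ i j : Fin n, q.1.Adj i j → q.2 i ≠ q.2 j}

/-- The map sending a solution `((e_{ij}), (x_i))` to the pair `(G, c)`, where `i` and `j`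
(with `i < j`) are adjacent in `G` iff `e_{ij} = 1`, and `c(i) = x_i`. -/
def solToColoredGraph (n k : ℕ) (p : (EIdx n → ℂ) × (Fin n → ℂ)) :
    SimpleGraph (Fin n) × (Fin n → ℂ) :=
  (SimpleGraph.fromRel (fun i j => ∃ h : i < j, p.1 ⟨(i, j), h⟩ = 1), p.2)

/-- For two `k`-th roots of unity `a`, `b`, the complete homogeneous sum of degree `k - 1`
vanishes exactly when `a ≠ b`. -/
theorem sum_pow_mul_pow_eq_zero_iff_ne {k : ℕ} (hk : k ≠ 0) {a b : ℂ}
    (ha : a ^ k = 1) (hb : b ^ k = 1) :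
    ∑ t ∈ Finset.range k, a ^ (k - 1 - t) * b ^ t = 0 ↔ a ≠ b := by
  constructor
  · rintro h rfl
    have hsum : ∑ t ∈ Finset.range k, a ^ (k - 1 - t) * a ^ t = k * a ^ (k - 1) := by
      rw [Finset.sum_congr rfl (g := fun _ => a ^ (k - 1)), Finset.sum_const,
        Finset.card_range, nsmul_eq_mul]
      intro t ht
      have := Finset.mem_range.mp ht
      rw [← pow_add]
      congr 1
      omega
    have ha0 : a ≠ 0 := by
      rintro rfl
      simp [hk] at ha
    rw [hsum] at h
    exact mul_ne_zero (Nat.cast_ne_zero.mpr hk) (pow_ne_zero _ ha0) h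
  · intro hab
    have h := geom_sum₂_mul b a k
    rw [ha, hb, sub_self] at h
    simp_rw [mul_comm (a ^ _)]
    exact (mul_eq_zero.mp h).resolve_right (sub_ne_zero.mpr hab.symm)

theorem solToColoredGraph_adj_of_lt {n k : ℕ} (p : (EIdx n → ℂ) × (Fin n → ℂ))
    {i j : Fin n} (h : i < j) :
    (solToColoredGraph n k p).1.Adj i j ↔ p.1 ⟨(i, j), h⟩ = 1 := by
  simp [solToColoredGraph, SimpleGraph.fromRel_adj, h, h.ne, h.not_gt]

/-- For `n, k ≥ 1`, the above map is a bijection from the solution set of the system of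
equations onto the set of pairs of a labeled graph on `{1,…,n}` together with a proper
`k`-coloring of it by `k`-th roots of unity. -/
theorem solToColoredGraph_bijOn (n k : ℕ) (hn : 1 ≤ n) (hk : 1 ≤ k) :
    Set.BijOn (solToColoredGraph n k) (SolSet n k) (ColoredGraphSet n k) := by
  have hk0 : k ≠ 0 := Nat.one_le_iff_ne_zero.mp hk
  have eq_zero_or_one : ∀ z : ℂ, z * (z - 1) = 0 → z = 0 ∨ z = 1 := fun z hz =>
    (mul_eq_zero.mp hz).imp_right sub_eq_zero.mp
  refine ⟨?_, ?_, ?_⟩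
  · rintro p ⟨-, hx, hex⟩
    have hx' : ∀ i, p.2 i ^ k = 1 := fun i => sub_eq_zero.mp (hx i)
    have ne_of_lt : ∀ i j, i < j → (solToColoredGraph n k p).1.Adj i j → p.2 i ≠ p.2 j := by
      intro i j hij hadj
      have hs := hex ⟨(i, j), hij⟩
      rw [(solToColoredGraph_adj_of_lt p hij).mp hadj, one_mul] at hs
      exact (sum_pow_mul_pow_eq_zero_iff_ne hk0 (hx' i) (hx' j)).mp hs
    refine ⟨hx', fun i j hadj => ?_⟩
    rcases lt_or_gt_of_ne hadj.ne with hij | hij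
    · exact ne_of_lt i j hij hadj
    · exact (ne_of_lt j i hij hadj.symm).symm
  · rintro p ⟨hp, -, -⟩ q ⟨hq, -, -⟩ hpq
    refine Prod.ext (funext fun ⟨⟨i, j⟩, hij⟩ => ?_) (congrArg Prod.snd hpq :)
    have h1 : p.1 ⟨(i, j), hij⟩ = 1 ↔ q.1 ⟨(i, j), hij⟩ = 1 := by
      rw [← solToColoredGraph_adj_of_lt (k := k) p hij, hpq, solToColoredGraph_adj_of_lt q hij]
    rcases eq_zero_or_one _ (hp ⟨(i, j), hij⟩) with h | h <;>
      rcases eq_zero_or_one _ (hq ⟨(i, j), hij⟩) with h' | h' <;> simp_all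
  · classical
    rintro ⟨G, c⟩ ⟨hc, hG⟩
    refine ⟨(fun q => if G.Adj q.1.1 q.1.2 then 1 else 0, c), ⟨?_, ?_, ?_⟩, ?_⟩
    · intro q
      dsimp only
      split_ifs <;> simp
    · exact fun i => sub_eq_zero.mpr (hc i)
    · intro q
      dsimp only
      split_ifs with hadj
      · rw [one_mul]
        exact (sum_pow_mul_pow_eq_zero_iff_ne hk0 (hc _) (hc _)).mpr (hG _ _ hadj)
      · exact zero_mul _
    · refine Prod.ext (SimpleGraph.ext (funext₂ fun i j => propext ?_)) rfl
      rcases lt_trichotomy i j with hij | rfl | hij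
      · rw [solToColoredGraph_adj_of_lt _ hij]
        simp
      · simp
      · rw [SimpleGraph.adj_comm, solToColoredGraph_adj_of_lt _ hij, G.adj_comm]
        simp
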